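/- arXiv:2605.01958 — 3 statements merged into one kernel-verified Lean document; each statement's English description precedes it below -/
import Mathlib

section
/- Let w : [0,∞) → ℝ be continuous with w(0) ≥ 0. Define ℓ(t) = sup_{s∈[0,t]} (w(s))⁻ and x(t) = w(t) + ℓ(t) for t ≥ 0. Then x(t) ≥ 0 for all t, ℓ is continuous, nondecreasing, with ℓ(0) = 0, and ∫_{[0,∞)} x(s) dℓ(s) = 0, the integral taken with respect to the Lebesgue–Stieltjes measure induced by ℓ. In other words, ℓ is a boundary term for x and the pair (x, ℓ) solves the one-dimensional Skorokhod problem for w. -/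
open MeasureTheory Set

noncomputable def nnegPart (r : ℝ) : ℝ := max (-r) 0

open Classical in
noncomputable def lsMeasure (f : ℝ → ℝ) : Measure ℝ :=
  if h : Monotone f ∧ Continuous f then
    StieltjesFunction.measure
      { toFun := f, mono' := h.1, right_continuous' := fun _ => h.2.continuousWithinAt }
  else 0

def IsBoundaryTerm (x ℓ : ℝ → ℝ) : Prop :=
  Continuous ℓ ∧ Monotone ℓ ∧ (∀ s ≤ (0:ℝ), ℓ s = 0) ∧
    ∫⁻ s in Set.Ici (0:ℝ), ENNReal.ofReal (x s) ∂(lsMeasure ℓ) = 0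

noncomputable def supNorm (f : ℝ → ℝ) (t : ℝ) : ℝ :=
  sSup ((fun s => |f s|) '' Set.Icc 0 t)

noncomputable def modCont (f : ℝ → ℝ) (t δ : ℝ) : ℝ :=
  sSup ((fun p : ℝ × ℝ => |f p.1 - f p.2|) ''
    {p : ℝ × ℝ | p.1 ∈ Set.Icc 0 t ∧ p.2 ∈ Set.Icc 0 t ∧ |p.1 - p.2| ≤ δ})

noncomputable def penalty (ε : ℝ) (x : ℝ) : ℝ :=
  if x ≤ -ε then ε⁻¹ else if x < 0 then -(x / ε ^ 2) else 0

def HomogeneousSystem (n : ℕ) (a : ℝ) (x0 : Fin n → ℝ)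
    (w x ℓ : Fin n → ℝ → ℝ) : Prop :=
  (∀ i, 0 ≤ x0 i) ∧ (∀ i, Continuous (w i)) ∧ (∀ i, w i 0 = 0) ∧
  (∀ i, Continuous (x i)) ∧ (∀ i t, 0 ≤ t → 0 ≤ x i t) ∧
  (∀ i, IsBoundaryTerm (x i) (ℓ i)) ∧
  (∀ i t, 0 ≤ t → x i t = x0 i + w i t + ℓ i t +
      a * (((n : ℝ) - 1)⁻¹ * ∑ j ∈ Finset.univ.erase i, ℓ j t))

def CompletelyS {n : ℕ} (R : Matrix (Fin n) (Fin n) ℝ) : Prop :=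
  ∀ J : Finset (Fin n), J.Nonempty →
    ∃ x : Fin n → ℝ, (∀ j ∈ J, 0 ≤ x j) ∧ ∀ i ∈ J, 0 < ∑ j ∈ J, R i j * x j

lemma nnegPart_nonneg (r : ℝ) : 0 ≤ nnegPart r := le_max_right _ _

lemma neg_le_nnegPart (r : ℝ) : -r ≤ nnegPart r := le_max_left _ _

lemma continuous_nnegPart : Continuous nnegPart :=
  continuous_neg.max continuous_const

/-- The running supremum on `[0, t]` as a supremum over the fixed interval `[0, 1]`. -/
lemma sSup_image_Icc_eq_sSup_image_unit {f : ℝ → ℝ} (h0 : f 0 = 0) (t : ℝ) :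
    sSup (f '' Icc 0 t) = sSup ((fun u => f (u * max t 0)) '' Icc (0 : ℝ) 1) := by
  rcases lt_or_ge t 0 with ht | ht
  · simp [Icc_eq_empty (not_le.2 ht), max_eq_right ht.le, h0]
  · rw [max_eq_left ht, ← Function.comp_def f (fun u => u * t), image_comp]
    have h : (fun u => u * t) '' Icc (0 : ℝ) 1 = Icc 0 t := by
      rw [image_mul_right_Icc zero_le_one ht]
      simp
    rw [h]

lemma continuous_sSup_image_Icc {f : ℝ → ℝ} (hf : Continuous f) (h0 : f 0 = 0) :
    Continuous fun t => sSup (f '' Icc 0 t) := by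
  simp_rw [sSup_image_Icc_eq_sSup_image_unit h0]
  refine isCompact_Icc.continuous_sSup (f := fun t u => f (u * max t 0)) ?_
  simp only [Function.HasUncurry.uncurry, id]
  fun_prop

lemma le_sSup_image_Icc {f : ℝ → ℝ} (hf : Continuous f) {r t : ℝ} (hr : r ∈ Icc 0 t) :
    f r ≤ sSup (f '' Icc 0 t) :=
  le_csSup (isCompact_Icc.image hf).bddAbove (mem_image_of_mem f hr)

lemma sSup_image_Icc_nonneg {f : ℝ → ℝ} (hf : ∀ r, 0 ≤ f r) (t : ℝ) :
    0 ≤ sSup (f '' Icc 0 t) :=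
  Real.sSup_nonneg (by rintro _ ⟨r, -, rfl⟩; exact hf r)

lemma monotone_sSup_image_Icc {f : ℝ → ℝ} (hf : Continuous f) (hf0 : ∀ r, 0 ≤ f r) :
    Monotone fun t => sSup (f '' Icc 0 t) := by
  intro s t hst
  refine Real.sSup_le ?_ (sSup_image_Icc_nonneg hf0 t)
  rintro _ ⟨r, hr, rfl⟩
  exact le_sSup_image_Icc hf ⟨hr.1, hr.2.trans hst⟩

lemma lsMeasure_Ioc {f : ℝ → ℝ} (hm : Monotone f) (hc : Continuous f) (a b : ℝ) :
    lsMeasure f (Ioc a b) = ENNReal.ofReal (f b - f a) := by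
  rw [lsMeasure, dif_pos ⟨hm, hc⟩, StieltjesFunction.measure_Ioc]

/-- A Lebesgue–Stieltjes measure does not charge a set near each point of which its
distribution function is constant. -/
lemma lsMeasure_eq_zero_of_locally_const {f : ℝ → ℝ} (hm : Monotone f) (hc : Continuous f)
    {A : Set ℝ} (hA : ∀ t ∈ A, ∃ δ > 0, f (t + δ) ≤ f (t - δ)) : lsMeasure f A = 0 := by
  refine measure_null_of_locally_null A fun t ht => ?_
  obtain ⟨δ, hδ, h⟩ := hA t ht
  refine ⟨Ioc (t - δ) (t + δ), mem_nhdsWithin_of_mem_nhds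
    (Ioc_mem_nhds (by linarith) (by linarith)), ?_⟩
  rw [lsMeasure_Ioc hm hc, ENNReal.ofReal_eq_zero]
  linarith

/-- The running supremum of the negative part of `w` is constant near each point at which it
exceeds `-w`. -/
lemma exists_sSup_nnegPart_le {w : ℝ → ℝ} (hw : Continuous w) (hw0 : nnegPart (w 0) = 0) {t : ℝ}
    (ht : 0 < w t + sSup ((fun s => nnegPart (w s)) '' Icc 0 t)) :
    ∃ δ > 0, sSup ((fun s => nnegPart (w s)) '' Icc 0 (t + δ)) ≤
      sSup ((fun s => nnegPart (w s)) '' Icc 0 (t - δ)) := by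
  have hf : Continuous fun s => nnegPart (w s) := continuous_nnegPart.comp hw
  have hc := continuous_sSup_image_Icc hf hw0
  have hnn := sSup_image_Icc_nonneg fun s => nnegPart_nonneg (w s)
  obtain ⟨c, hc₁, hc₂⟩ := exists_between (neg_lt_iff_pos_add'.2 ht)
  obtain ⟨ε, hε, hball⟩ := Metric.eventually_nhds_iff.1
    ((hw.neg.continuousAt.eventually_lt_const hc₁).and
      (hc.continuousAt.eventually_const_lt hc₂))
  refine ⟨ε / 2, by positivity, Real.sSup_le ?_ (hnn _)⟩
  rintro _ ⟨r, hr, rfl⟩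
  rcases le_or_gt r (t - ε / 2) with hrt | hrt
  · exact le_sSup_image_Icc hf ⟨hr.1, hrt⟩
  · have h₁ := (hball (y := r) (by
      rw [Real.dist_eq, abs_lt]; constructor <;> linarith [hr.2])).1
    have h₂ := (hball (y := t - ε / 2) (by
      rw [Real.dist_eq, abs_lt]; constructor <;> linarith)).2
    exact max_le (h₁.trans h₂).le (hnn _)

theorem stmt2 (w ℓ x : ℝ → ℝ)
    (hw : Continuous w) (hw0 : 0 ≤ w 0)
    (hℓ : ∀ t, ℓ t = sSup ((fun s => nnegPart (w s)) '' Set.Icc 0 t))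
    (hx : ∀ t, x t = w t + ℓ t) :
    (∀ t, 0 ≤ t → 0 ≤ x t) ∧ IsBoundaryTerm x ℓ := by
  obtain rfl : ℓ = fun t => sSup ((fun s => nnegPart (w s)) '' Set.Icc 0 t) := funext hℓ
  have hf : Continuous fun s => nnegPart (w s) := continuous_nnegPart.comp hw
  have h0 : nnegPart (w 0) = 0 := max_eq_right (neg_nonpos.2 hw0)
  have hc := continuous_sSup_image_Icc hf h0
  have hm := monotone_sSup_image_Icc hf fun s => nnegPart_nonneg (w s)
  refine ⟨fun t ht => ?_, hc, hm, fun s hs => ?_, ?_⟩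
  · rw [hx]
    linarith [neg_le_nnegPart (w t), le_sSup_image_Icc hf (right_mem_Icc.2 ht)]
  · simp [sSup_image_Icc_eq_sSup_image_unit (f := fun s => nnegPart (w s)) h0, max_eq_right hs, h0]
  · refine (lintegral_congr_ae (ae_restrict_of_ae ?_)).trans lintegral_zero
    refine lsMeasure_eq_zero_of_locally_const hm hc fun t ht => exists_sSup_nnegPart_le hw h0 ?_
    simpa [hx] using ht
end

section
/- Let −1 < a < 0 and let (x_{0,i}, w_i, x_i, ℓ_i)_{i=1,…,n} be a homogeneous reflected system with parameter a. Then for every i and every t ≥ 0, ℓ_i(t) ≤ ‖w_i‖_t + 2|a|(1 − |a|)⁻¹ ⟨‖w‖_t⟩, where ⟨‖w‖_t⟩ = n⁻¹∑_{j=1}^n ‖w_j‖_t. -/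
open MeasureTheory Set

theorem le_supNorm {f : ℝ → ℝ} (hf : Continuous f) {s t : ℝ} (hs : s ∈ Icc 0 t) :
    |f s| ≤ supNorm f t :=
  le_csSup (isCompact_Icc.bddAbove_image hf.abs.continuousOn) ⟨s, hs, rfl⟩

theorem IsBoundaryTerm.nonneg {x ℓ : ℝ → ℝ} (h : IsBoundaryTerm x ℓ) (t : ℝ) : 0 ≤ ℓ t := by
  rcases le_total t 0 with ht | ht
  · exact (h.2.2.1 t ht).ge
  · exact (h.2.2.1 0 le_rfl).ge.trans (h.2.1 ht)

/-- A boundary term does not increase while `x` stays away from zero. -/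
theorem IsBoundaryTerm.le_of_pos {x ℓ : ℝ → ℝ} (h : IsBoundaryTerm x ℓ) {u t δ : ℝ}
    (hu : 0 ≤ u) (hδ : 0 < δ) (hx : ∀ s ∈ Ioc u t, δ ≤ x s) : ℓ t ≤ ℓ u := by
  obtain ⟨hc, hm, -, hint⟩ := h
  by_contra! hlt
  have hmeas : lsMeasure ℓ (Ioc u t) = ENNReal.ofReal (ℓ t - ℓ u) := by
    rw [lsMeasure, dif_pos ⟨hm, hc⟩, StieltjesFunction.measure_Ioc]
  have hle : ENNReal.ofReal δ * lsMeasure ℓ (Ioc u t) ≤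
      ∫⁻ s in Ici (0 : ℝ), ENNReal.ofReal (x s) ∂(lsMeasure ℓ) :=
    calc ENNReal.ofReal δ * lsMeasure ℓ (Ioc u t)
        = ∫⁻ _ in Ioc u t, ENNReal.ofReal δ ∂(lsMeasure ℓ) := (setLIntegral_const _ _).symm
      _ ≤ ∫⁻ s in Ioc u t, ENNReal.ofReal (x s) ∂(lsMeasure ℓ) :=
          setLIntegral_mono' measurableSet_Ioc fun s hs => ENNReal.ofReal_le_ofReal (hx s hs)
      _ ≤ _ := lintegral_mono_set fun s hs => hu.trans hs.1.le
  rw [hint, hmeas] at hle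
  have hpos : 0 < ENNReal.ofReal δ * ENNReal.ofReal (ℓ t - ℓ u) :=
    ENNReal.mul_pos (ENNReal.ofReal_pos.2 hδ).ne' (ENNReal.ofReal_pos.2 (sub_pos.2 hlt)).ne'
  exact hpos.not_ge hle

/-- A boundary term for `x` is bounded by any `C` such that `ℓ - C` stays below `x`. -/
theorem IsBoundaryTerm.le_of_sub_le {x ℓ : ℝ → ℝ} (h : IsBoundaryTerm x ℓ) {t C : ℝ}
    (ht : 0 ≤ t) (hC : 0 ≤ C) (hx : ∀ s ∈ Icc 0 t, ℓ s - C ≤ x s) : ℓ t ≤ C := by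
  by_contra! hlt
  have h0 : ℓ 0 = 0 := h.2.2.1 0 le_rfl
  obtain ⟨u, hu, hmid⟩ := intermediate_value_Icc ht h.1.continuousOn
    (show (C + ℓ t) / 2 ∈ Icc (ℓ 0) (ℓ t) by constructor <;> linarith)
  have hle := h.le_of_pos (u := u) (t := t) (δ := ℓ u - C) hu.1 (by linarith) fun s hs => by
    have hxs := hx s ⟨hu.1.trans hs.1.le, hs.2⟩
    have hmono := h.2.1 hs.1.le
    linarith
  linarith

theorem stmt7 (n : ℕ) (hn : 2 ≤ n) (a : ℝ) (ha1 : -1 < a) (ha2 : a < 0)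
    (x0 : Fin n → ℝ) (w x ℓ : Fin n → ℝ → ℝ)
    (hsys : HomogeneousSystem n a x0 w x ℓ) :
    ∀ i t, 0 ≤ t →
      ℓ i t ≤ supNorm (w i) t
        + 2 * |a| * (1 - |a|)⁻¹ * ((n : ℝ)⁻¹ * ∑ j, supNorm (w j) t) := by
  obtain ⟨hx0, hw, -, -, -, hb, heq⟩ := hsys
  intro i t ht
  have hn2 : (2 : ℝ) ≤ n := by exact_mod_cast hn
  rw [abs_of_neg ha2, sub_neg_eq_add]
  set S := ∑ j, ℓ j t with hS
  set W := ∑ j, supNorm (w j) t with hW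
  set c := ((n : ℝ) - 1)⁻¹ with hc
  have hc0 : 0 < c := inv_pos.2 (by linarith)
  have hc1 : c * ((n : ℝ) - 1) = 1 := inv_mul_cancel₀ (by linarith)
  have herase : ∀ j s, ∑ k ∈ Finset.univ.erase j, ℓ k s = ∑ k, ℓ k s - ℓ j s := fun j s => by
    rw [← Finset.add_sum_erase _ _ (Finset.mem_univ j)]; ring
  have hW0 : ∀ j, 0 ≤ supNorm (w j) t := fun j =>
    (abs_nonneg _).trans (le_supNorm (hw j) ⟨le_rfl, ht⟩)
  have hE0 : ∀ j, 0 ≤ ∑ k ∈ Finset.univ.erase j, ℓ k t := fun j =>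
    Finset.sum_nonneg fun k _ => (hb k).nonneg t
  have key : ∀ j, ℓ j t ≤ supNorm (w j) t + -a * (c * (S - ℓ j t)) := fun j => by
    rw [hS, ← herase]
    refine (hb j).le_of_sub_le ht (add_nonneg (hW0 j)
      (mul_nonneg (by linarith) (mul_nonneg hc0.le (hE0 j)))) fun s hs => ?_
    have hmono : -a * (c * ∑ k ∈ Finset.univ.erase j, ℓ k s) ≤
        -a * (c * ∑ k ∈ Finset.univ.erase j, ℓ k t) :=
      mul_le_mul_of_nonneg_left (mul_le_mul_of_nonneg_left
        (Finset.sum_le_sum fun k _ => (hb k).2.1 hs.2) hc0.le) (by linarith)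
    have hws := (abs_le.1 (le_supNorm (hw j) hs)).1
    rw [heq j s hs.1]
    have h0 := hx0 j
    linarith
  have hsum : S ≤ W + -a * S := by
    have h1 : S ≤ ∑ j, (supNorm (w j) t + -a * (c * (S - ℓ j t))) :=
      Finset.sum_le_sum fun j _ => key j
    have h2 : ∑ j, (supNorm (w j) t + -a * (c * (S - ℓ j t))) =
        W + -a * (c * ((n : ℝ) - 1) * S) := by
      rw [Finset.sum_add_distrib, ← Finset.mul_sum, ← Finset.mul_sum, Finset.sum_sub_distrib,
        Finset.sum_const, Finset.card_univ, Fintype.card_fin, nsmul_eq_mul, ← hS]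
      ring
    rwa [h2, hc1, one_mul] at h1
  have hWnn : 0 ≤ W := Finset.sum_nonneg fun j _ => hW0 j
  have hS1 : S ≤ (1 + a)⁻¹ * W := by
    rw [inv_mul_eq_div, le_div_iff₀ (by linarith)]
    linarith
  have hcn : c ≤ 2 * (n : ℝ)⁻¹ := by
    rw [hc, ← div_eq_mul_inv, inv_eq_one_div, div_le_div_iff₀ (by linarith) (by linarith)]
    linarith
  calc ℓ i t ≤ supNorm (w i) t + -a * (c * (S - ℓ i t)) := key i
    _ ≤ supNorm (w i) t + -a * (2 * (n : ℝ)⁻¹ * ((1 + a)⁻¹ * W)) := by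
        have hi := (hb i).nonneg t
        have h1a : 0 ≤ (1 + a)⁻¹ * W := mul_nonneg (inv_nonneg.2 (by linarith)) hWnn
        refine add_le_add le_rfl (mul_le_mul_of_nonneg_left ?_ (by linarith))
        calc c * (S - ℓ i t) ≤ c * ((1 + a)⁻¹ * W) :=
              mul_le_mul_of_nonneg_left (by linarith) hc0.le
          _ ≤ _ := mul_le_mul_of_nonneg_right hcn h1a
    _ = _ := by ring
end

section
/- Fix n ≥ 2, t > 0, ε_ρ ∈ (0,1) with nε_ρ ≥ 1, a real number a, and real numbers ρ_ij (i,j ∈ {1,…,n}, i ≠ j) with |ρ_ij| ≤ 1 − ε_ρ for all i ≠ j. Suppose (x̂_i, ℓ̂_i)_{i=1,…,n} satisfies: x̂_i : [0,∞)→[0,∞) continuous, ℓ̂_i a boundary term for x̂_i, and x̂_i(s) = x_{0,i} + w_i(s) + ℓ̂_i(s) + (n−1)⁻¹∑_{j≠i} ρ_ij ℓ̂_j(s) for all s ≥ 0, and that (x_{0,i}, w_i, x_i, ℓ_i)_{i=1,…,n} is a homogeneous reflected system with parameter a, with the same constants x_{0,i} ≥ 0 and the same continuous functions w_i. Define C_i(s)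 = (n−1)⁻¹∑_{j≠i}(ρ_ij − a) ℓ_j(s). Then max_{i} ( ‖x̂_i − x_i‖_t ∨ ‖ℓ̂_i − ℓ_i‖_t ) ≤ (3 + 2/ε_ρ) max_i ‖C_i‖_t. -/
open MeasureTheory Set

theorem IsBoundaryTerm.eq_of_forall_pos {x ℓ : ℝ → ℝ} (h : IsBoundaryTerm x ℓ)
    (hx : Continuous x) {r s : ℝ} (hr : 0 ≤ r) (hrs : r ≤ s)
    (hpos : ∀ u ∈ Ioc r s, 0 < x u) : ℓ s = ℓ r := by
  obtain ⟨hc, hm, -, hint⟩ := h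
  have hae := (setLIntegral_eq_zero_iff measurableSet_Ici
    (ENNReal.measurable_ofReal.comp hx.measurable)).1 hint
  have hnull : lsMeasure ℓ (Ioc r s) = 0 := by
    refine measure_mono_null (fun u hu => ?_) (ae_iff.1 hae)
    simp only [mem_ofPred_eq, mem_Ici, Function.comp, Classical.not_imp,
      ENNReal.ofReal_eq_zero, not_le]
    exact ⟨hr.trans hu.1.le, hpos u hu⟩
  rw [lsMeasure, dif_pos ⟨hm, hc⟩, StieltjesFunction.measure_Ioc, ENNReal.ofReal_eq_zero] at hnull
  have hle : ℓ s - ℓ r ≤ 0 := hnull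
  linarith [hm hrs]

/-- One half of the Lipschitz estimate for the one-dimensional Skorokhod map. -/
theorem IsBoundaryTerm.sub_le {x y ℓ m : ℝ → ℝ} (hℓ : IsBoundaryTerm x ℓ)
    (hm : IsBoundaryTerm y m) (hx : Continuous x) {t K : ℝ} (hy : ∀ s, 0 ≤ s → 0 ≤ y s)
    (hK : ∀ s ∈ Icc 0 t, |(x s - y s) - (ℓ s - m s)| ≤ K) {s : ℝ} (hs : s ∈ Icc 0 t) :
    ℓ s - m s ≤ K := by
  have hK0 : 0 ≤ K := (abs_nonneg _).trans (hK s hs)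
  have hcd : Continuous fun u => ℓ u - m u := hℓ.1.sub hm.1
  have hcomp : IsCompact (Icc 0 s ∩ {u | ℓ u - m u ≤ K}) :=
    isCompact_Icc.inter_right (isClosed_le hcd continuous_const)
  obtain ⟨r, ⟨⟨hr0, hrs⟩, hrK⟩, hmax⟩ := hcomp.exists_isGreatest
    ⟨0, ⟨le_rfl, hs.1⟩, by simp [hℓ.2.2.1 0 le_rfl, hm.2.2.1 0 le_rfl, hK0]⟩
  have hpos : ∀ u ∈ Ioc r s, 0 < x u := by
    intro u hu
    have hu0 : 0 ≤ u := hr0.trans hu.1.le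
    have hgt : K < ℓ u - m u := by
      by_contra! hle
      exact absurd (hmax ⟨⟨hu0, hu.2⟩, hle⟩) (not_le.2 hu.1)
    have := (abs_le.1 (hK u ⟨hu0, hu.2.trans hs.2⟩)).1
    linarith [hy u hu0]
  have heq := hℓ.eq_of_forall_pos hx hr0 hrs hpos
  have hrK' : ℓ r - m r ≤ K := hrK
  linarith [hm.2.1 hrs]

theorem abs_le_supNorm {f : ℝ → ℝ} (hf : Continuous f) {t s : ℝ} (hs : s ∈ Icc 0 t) :
    |f s| ≤ supNorm f t :=
  le_csSup (isCompact_Icc.bddAbove_image hf.abs.continuousOn) ⟨s, hs, rfl⟩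

theorem supNorm_le {f : ℝ → ℝ} {t K : ℝ} (ht : 0 ≤ t) (h : ∀ s ∈ Icc 0 t, |f s| ≤ K) :
    supNorm f t ≤ K :=
  csSup_le ⟨_, 0, ⟨le_rfl, ht⟩, rfl⟩ (by rintro _ ⟨s, hs, rfl⟩; exact h s hs)

theorem abs_inv_mul_sum_erase_le {n : ℕ} (hn : 2 ≤ n) {b M : ℝ} (hb : 0 ≤ b) (i : Fin n)
    {r d : Fin n → ℝ} (hr : ∀ j, i ≠ j → |r j| ≤ b) (hd : ∀ j, |d j| ≤ M) :
    |((n : ℝ) - 1)⁻¹ * ∑ j ∈ Finset.univ.erase i, r j * d j| ≤ b * M := by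
  have hn' : (0 : ℝ) < (n : ℝ) - 1 := by
    have : (2 : ℝ) ≤ n := by exact_mod_cast hn
    linarith
  have hsum : |∑ j ∈ Finset.univ.erase i, r j * d j| ≤ ((n : ℝ) - 1) * (b * M) := by
    refine (Finset.abs_sum_le_sum_abs _ _).trans ?_
    refine (Finset.sum_le_card_nsmul _ _ (b * M) fun j hj => ?_).trans_eq ?_
    · rw [abs_mul]
      exact mul_le_mul (hr j (Finset.ne_of_mem_erase hj).symm) (hd j) (abs_nonneg _) hb
    · rw [Finset.card_erase_of_mem (Finset.mem_univ i), Finset.card_univ, Fintype.card_fin,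
        nsmul_eq_mul, Nat.cast_sub (by lia), Nat.cast_one]
  rw [abs_mul, abs_of_pos (inv_pos.2 hn'), inv_mul_le_iff₀ hn']
  exact hsum

theorem stmt10 (n : ℕ) (hn : 2 ≤ n) (t : ℝ) (ht : 0 < t)
    (ερ : ℝ) (hερ0 : 0 < ερ) (hερ1 : ερ < 1) (hnε : 1 ≤ (n : ℝ) * ερ)
    (a : ℝ) (ρ : Fin n → Fin n → ℝ)
    (hρ : ∀ i j, i ≠ j → |ρ i j| ≤ 1 - ερ)
    (x0 : Fin n → ℝ) (w : Fin n → ℝ → ℝ)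
    (xhat ℓhat : Fin n → ℝ → ℝ)
    (hxhatc : ∀ i, Continuous (xhat i))
    (hxhatnn : ∀ i s, 0 ≤ s → 0 ≤ xhat i s)
    (hbhat : ∀ i, IsBoundaryTerm (xhat i) (ℓhat i))
    (heqhat : ∀ i s, 0 ≤ s → xhat i s = x0 i + w i s + ℓhat i s
        + ((n : ℝ) - 1)⁻¹ * ∑ j ∈ Finset.univ.erase i, ρ i j * ℓhat j s)
    (x ℓ : Fin n → ℝ → ℝ)
    (hsys : HomogeneousSystem n a x0 w x ℓ)
    (C : Fin n → ℝ → ℝ)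
    (hC : ∀ i s, C i s = ((n : ℝ) - 1)⁻¹ * ∑ j ∈ Finset.univ.erase i, (ρ i j - a) * ℓ j s) :
    ∀ i, max (supNorm (fun s => xhat i s - x i s) t)
             (supNorm (fun s => ℓhat i s - ℓ i s) t)
      ≤ (3 + 2 / ερ) * ⨆ j, supNorm (C j) t := by
  obtain ⟨-, -, -, hxc, hxnn, hb, heq⟩ := hsys
  have : Nonempty (Fin n) := ⟨⟨0, by lia⟩⟩
  set c : ℝ := ⨆ j, supNorm (C j) t
  set M : ℝ := ⨆ j, supNorm (fun s => ℓhat j s - ℓ j s) t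
  have hCc : ∀ j, Continuous (C j) := by
    intro j
    rw [funext (hC j)]
    exact continuous_const.mul
      (continuous_finsetSum _ fun k _ => continuous_const.mul (hb k).1)
  have hCle : ∀ j, ∀ s ∈ Icc 0 t, |C j s| ≤ c := fun j s hs =>
    (abs_le_supNorm (hCc j) hs).trans
      (le_ciSup (f := fun j => supNorm (C j) t) (Finite.bddAbove_range _) j)
  have hDle : ∀ j, ∀ s ∈ Icc 0 t, |ℓhat j s - ℓ j s| ≤ M := fun j s hs =>
    (abs_le_supNorm ((hbhat j).1.sub (hb j).1) hs).trans
      (le_ciSup (f := fun j => supNorm (fun s => ℓhat j s - ℓ j s) t)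
        (Finite.bddAbove_range _) j)
  have hdiff : ∀ j s, 0 ≤ s → (xhat j s - x j s) - (ℓhat j s - ℓ j s) =
      ((n : ℝ) - 1)⁻¹ * ∑ k ∈ Finset.univ.erase j, ρ j k * (ℓhat k s - ℓ k s) + C j s := by
    intro j s hs
    rw [heqhat j s hs, heq j s hs, hC]
    simp only [sub_mul, mul_sub, Finset.sum_sub_distrib, ← Finset.mul_sum]
    ring
  have hK : ∀ j, ∀ s ∈ Icc 0 t,
      |(xhat j s - x j s) - (ℓhat j s - ℓ j s)| ≤ (1 - ερ) * M + c := by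
    intro j s hs
    rw [hdiff j s hs.1]
    exact (abs_add_le _ _).trans (add_le_add
      (abs_inv_mul_sum_erase_le hn (by linarith) j (hρ j) fun k => hDle k s hs) (hCle j s hs))
  have hMle : M ≤ (1 - ερ) * M + c := by
    refine ciSup_le fun j => supNorm_le ht.le fun s hs => abs_le'.2 ⟨?_, ?_⟩
    · exact (hbhat j).sub_le (hb j) (hxhatc j) (hxnn j) (hK j) hs
    · rw [neg_sub]
      refine (hb j).sub_le (hbhat j) (hxc j) (hxhatnn j) (fun u hu => ?_) hs
      rw [← abs_neg]
      convert hK j u hu using 2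
      ring
  have hMc : M ≤ c / ερ := by
    rw [le_div_iff₀ hερ0]
    linarith
  have h0 : (0 : ℝ) ∈ Icc 0 t := ⟨le_rfl, ht.le⟩
  have hc0 : 0 ≤ c := (abs_nonneg _).trans (hCle ⟨0, by lia⟩ 0 h0)
  have hM0 : 0 ≤ M := (abs_nonneg _).trans (hDle ⟨0, by lia⟩ 0 h0)
  have hcε : (3 + 2 / ερ) * c = 3 * c + 2 * (c / ερ) := by ring
  have hεM : 0 ≤ ερ * M := by positivity
  intro i
  refine max_le (supNorm_le ht.le fun s hs => ?_) (supNorm_le ht.le fun s hs => ?_)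
  · have h1 := abs_le.1 (hK i s hs)
    have h2 := abs_le.1 (hDle i s hs)
    rw [hcε, abs_le]
    constructor <;> linarith
  · rw [hcε]
    linarith [hDle i s hs]
end
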